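/- arXiv:1805.05293 — 11 statements merged into one kernel-verified Lean document; each statement's English description precedes it below -/
import Mathlib

section
/- Let n ≥ 3 be an odd integer such that every prime divisor p of n satisfies p ≠ 3 and the multiplicative order of 2 modulo p is congruent to 2 modulo 4. Then ℤ_n admits a strong Skolem starter. -/
/-- A starter in `ZMod n` (`n` odd): a partition of the nonzero elements of `ZMod n`
into unordered pairs such that the differences `±(s - t)` over all pairs are exactly
the nonzero elements of `ZMod n`. -/
def IsStarter (n : ℕ) (S : Finset (Sym2 (ZMod n))) : Prop :=
  (∀ s ∈ S, ¬ s.IsDiag) ∧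
  (∀ s ∈ S, ∀ x ∈ s, x ≠ (0 : ZMod n)) ∧
  (∀ x : ZMod n, x ≠ 0 → ∃! s, s ∈ S ∧ x ∈ s) ∧
  (∀ x : ZMod n, x ≠ 0 →
    ∃! s, s ∈ S ∧ ∃ a b : ZMod n, s = s(a, b) ∧ (x = a - b ∨ x = b - a))

/-- A starter is strong if the sums `s + t` over its pairs are pairwise distinct and
all nonzero. -/
def IsStrongStarter (n : ℕ) (S : Finset (Sym2 (ZMod n))) : Prop :=
  IsStarter n S ∧
  (∀ s ∈ S, ∀ a b : ZMod n, s = s(a, b) → a + b ≠ 0) ∧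
  (∀ s ∈ S, ∀ t ∈ S, ∀ a b c d : ZMod n,
    s = s(a, b) → t = s(c, d) → a + b = c + d → s = t)

/-- A starter is Skolem if it can be written as `{{sᵢ, tᵢ}}_{i=1}^{(n-1)/2}` with
`tᵢ - sᵢ ≡ i (mod n)` and `tᵢ > sᵢ` as integer representatives. -/
def IsSkolemStarter (n : ℕ) (S : Finset (Sym2 (ZMod n))) : Prop :=
  IsStarter n S ∧
  ∃ st : ℕ → ZMod n × ZMod n,
    S = (Finset.Icc 1 ((n - 1) / 2)).image (fun i => s((st i).1, (st i).2)) ∧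
    ∀ i ∈ Finset.Icc 1 ((n - 1) / 2),
      (st i).2 - (st i).1 = (i : ZMod n) ∧ (st i).1.val < (st i).2.val

/-- A starter in `ZMod n` is cardioidal if each of its pairs has the form
`{x, 2x}` for some nonzero `x`. -/
def IsCardioidal (n : ℕ) (S : Finset (Sym2 (ZMod n))) : Prop :=
  ∀ s ∈ S, ∃ x : ZMod n, x ≠ 0 ∧ s = s(x, 2 * x)

/-- A starter is skew if the sums `±(s + t)` over all its pairs are exactly the
nonzero elements of `ZMod n`. -/
def IsSkewStarter (n : ℕ) (S : Finset (Sym2 (ZMod n))) : Prop :=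
  IsStarter n S ∧
  ∀ x : ZMod n, x ≠ 0 →
    ∃! s, s ∈ S ∧ ∃ a b : ZMod n, s = s(a, b) ∧ (x = a + b ∨ x = -(a + b))

theorem mul_dvd_pow_add_one {a b X : ℤ} {k : ℕ} (ha : a = k) (hk : Odd k) (hX : a ∣ X + 1)
    (hb : b ∣ X + 1) : a * b ∣ X ^ k + 1 := by
  have hgeom : (∑ i ∈ Finset.range k, (-X) ^ i) * (X + 1) = X ^ k + 1 := by
    have h := geom_sum_mul (-X) k
    rw [hk.neg_pow] at h
    linear_combination -h
  rw [← hgeom]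
  refine mul_dvd_mul ?_ hb
  subst ha
  rw [← ZMod.intCast_zmod_eq_zero_iff_dvd] at hX ⊢
  have hX1 : -(X : ZMod k) = 1 := by
    push_cast at hX
    linear_combination -hX
  push_cast
  simp [hX1]

/-- If every prime divisor `p` of `n` has `orderOf (2 : ZMod p) % 4 = 2`, then `-1` is an odd
power of `2` modulo `n`. -/
theorem exists_odd_dvd_two_pow_add_one (n : ℕ) (hn : n ≠ 0)
    (h : ∀ p : ℕ, p.Prime → p ∣ n → orderOf (2 : ZMod p) % 4 = 2) :
    ∃ m : ℕ, Odd m ∧ (n : ℤ) ∣ 2 ^ m + 1 := by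
  induction n using induction_on_primes with
  | zero => exact absurd rfl hn
  | one => exact ⟨1, odd_one, by simp⟩
  | prime_mul p a hp ih =>
    obtain ⟨s, hs, has⟩ := ih (right_ne_zero_of_mul hn)
      fun q hq hqa => h q hq (hqa.mul_left p)
    have hord := h p hp (dvd_mul_right p a)
    have := Fact.mk hp
    have hp2 : p ≠ 2 := by
      rintro rfl
      have : (2 : ZMod 2) = 0 := rfl
      rw [this, orderOf_zero] at hord
      omega
    obtain ⟨r, hr, hpr⟩ : ∃ r : ℕ, Odd r ∧ (p : ℤ) ∣ 2 ^ r + 1 := by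
      set d := orderOf (2 : ZMod p) with hd
      refine ⟨d / 2, by rw [Nat.odd_iff]; omega, ?_⟩
      rw [← ZMod.intCast_zmod_eq_zero_iff_dvd]
      have hsq : ((2 : ZMod p) ^ (d / 2)) ^ 2 = 1 := by
        rw [← pow_mul, Nat.div_mul_cancel (by omega), hd, pow_orderOf_eq_one]
      rcases sq_eq_one_iff.mp hsq with h1 | h1
      · have := Nat.le_of_dvd (by omega) (orderOf_dvd_of_pow_eq_one h1)
        omega
      · push_cast
        rw [h1, neg_add_cancel]
    refine ⟨r * s * p, (hr.mul hs).mul (hp.odd_of_ne_two hp2), ?_⟩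
    rw [pow_mul]
    push_cast
    refine mul_dvd_pow_add_one rfl (hp.odd_of_ne_two hp2) (hpr.trans ?_) (has.trans ?_)
    · simpa [pow_mul] using hs.add_dvd_pow_add_pow ((2 : ℤ) ^ r) 1
    · simpa [pow_mul, mul_comm r s] using hr.add_dvd_pow_add_pow ((2 : ℤ) ^ s) 1

/-- The least representative of the orbit of `x` under multiplication by `u`. -/
noncomputable def orbitMin {n : ℕ} (u x : ZMod n) : ℕ :=
  sInf (Set.range fun k : ℕ => (u ^ k * x).val)

theorem orbitMin_mem {n : ℕ} (u x : ZMod n) : ∃ k : ℕ, (u ^ k * x).val = orbitMin u x :=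
  Nat.sInf_mem (Set.range_nonempty fun k : ℕ => (u ^ k * x).val)

theorem orbitMin_mul {n m : ℕ} {u : ZMod n} (hm : 0 < m) (hu : u ^ m = 1) (x : ZMod n) :
    orbitMin u (u * x) = orbitMin u x := by
  unfold orbitMin
  congr 1
  ext v
  constructor
  · rintro ⟨k, rfl⟩
    exact ⟨k + 1, by simp only [pow_succ, mul_assoc]⟩
  · rintro ⟨k, rfl⟩
    refine ⟨k + (m - 1), ?_⟩
    simp only
    rw [← mul_assoc, ← pow_succ, add_assoc, Nat.sub_add_cancel hm, pow_add, hu, mul_one]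

theorem orbitMin_neg_ne {n m : ℕ} [NeZero n] {u x : ZMod n} (hm : Odd m) (hu : u ^ m = 1)
    (h2 : IsUnit (2 : ZMod n)) (hx : x ≠ 0) : orbitMin u (-x) ≠ orbitMin u x := by
  intro h
  obtain ⟨k, hk⟩ := orbitMin_mem u x
  obtain ⟨j, hj⟩ := orbitMin_mem u (-x)
  have hkj : u ^ k * x = u ^ j * -x := ZMod.val_injective n (by rw [hk, hj, h])
  have hpow : u ^ (k + (m - 1) * j) * x = -x := by
    rw [pow_add, mul_right_comm, hkj, mul_right_comm, ← pow_add, add_comm j,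
      ← Nat.succ_mul, Nat.succ_eq_add_one, Nat.sub_add_cancel hm.pos, pow_mul, hu, one_pow,
      one_mul]
  have hiter : ∀ l : ℕ, (u ^ (k + (m - 1) * j)) ^ l * x = (-1) ^ l * x := by
    intro l
    induction l with
    | zero => simp
    | succ l ih =>
      rw [pow_succ, mul_assoc, hpow, mul_neg, ih, pow_succ]
      ring
  have hm' := hiter m
  rw [pow_right_comm, hu, one_pow, hm.neg_one_pow] at hm'
  exact hx ((h2.mul_right_eq_zero).mp (by linear_combination hm'))

/-- If `-1` is an odd power of `2` modulo `n`, the nonzero residues have a half-system closed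
under multiplication by `-2`. -/
theorem exists_halfSystem {n m : ℕ} [NeZero n] (hm : Odd m) (h : (2 : ZMod n) ^ m = -1)
    (h2 : IsUnit (2 : ZMod n)) :
    ∃ A : Finset (ZMod n), 0 ∉ A ∧ (∀ x ≠ 0, x ∈ A ∨ -x ∈ A) ∧ (∀ x ∈ A, -x ∉ A) ∧
      ∀ x ∈ A, -(2 * x) ∈ A := by
  classical
  have hu : (-2 : ZMod n) ^ m = 1 := by rw [hm.neg_pow, h, neg_neg]
  refine ⟨Finset.univ.filter fun x => orbitMin (-2) x < orbitMin (-2) (-x), ?_, ?_, ?_, ?_⟩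
  · simp
  · intro x hx
    have := orbitMin_neg_ne hm hu h2 hx
    simp only [Finset.mem_filter, Finset.mem_univ, true_and, neg_neg]
    omega
  · intro x hx
    simp only [Finset.mem_filter, Finset.mem_univ, true_and, neg_neg] at hx ⊢
    omega
  · intro x hx
    simp only [Finset.mem_filter, Finset.mem_univ, true_and] at hx ⊢
    rwa [← mul_neg, ← neg_mul_comm, ← mul_neg, orbitMin_mul hm.pos hu, orbitMin_mul hm.pos hu]

section HalfSystem

variable {n : ℕ} {A : Finset (ZMod n)}

theorem isStarter_image_of_halfSystem [DecidableEq (ZMod n)] (h2 : IsUnit (2 : ZMod n))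
    (h0 : 0 ∉ A) (hcov : ∀ x ≠ 0, x ∈ A ∨ -x ∈ A) (hneg : ∀ x ∈ A, -x ∉ A)
    (hmul : ∀ x ∈ A, -(2 * x) ∈ A) : IsStarter n (A.image fun x => s(x, 2 * x)) := by
  have hne : ∀ x ∈ A, x ≠ 0 := fun x hx hx0 => h0 (hx0 ▸ hx)
  have hdbl : ∀ x ∈ A, 2 * x ∉ A := fun x hx hx2 => hneg _ hx2 (hmul x hx)
  refine ⟨?_, ?_, ?_, ?_⟩
  · simp only [Finset.forall_mem_image, Sym2.mk_isDiag_iff]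
    intro x hx hd
    exact hne x hx (by linear_combination -hd)
  · simp only [Finset.forall_mem_image, Sym2.mem_iff]
    rintro x hx y (rfl | rfl)
    · exact hne _ hx
    · exact fun h => hne x hx (h2.mul_right_eq_zero.mp h)
  · intro x hx
    by_cases hxA : x ∈ A
    · refine ⟨s(x, 2 * x), ⟨Finset.mem_image_of_mem _ hxA, Sym2.mem_mk_left _ _⟩, ?_⟩
      rintro _ ⟨hs, hxs⟩
      obtain ⟨y, hy, rfl⟩ := Finset.mem_image.mp hs
      rcases Sym2.mem_iff.mp hxs with rfl | rfl
      · rfl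
      · exact absurd hxA (hdbl y hy)
    · obtain ⟨z, rfl⟩ : ∃ z, x = 2 * z := h2.dvd
      have hz : z ∈ A := by
        refine (hcov z (right_ne_zero_of_mul hx)).resolve_right fun hz => hxA ?_
        simpa using hmul _ hz
      refine ⟨s(z, 2 * z), ⟨Finset.mem_image_of_mem _ hz, Sym2.mem_mk_right _ _⟩, ?_⟩
      rintro _ ⟨hs, hxs⟩
      obtain ⟨y, hy, rfl⟩ := Finset.mem_image.mp hs
      rcases Sym2.mem_iff.mp hxs with rfl | hyz
      · exact absurd hy hxA
      · rw [h2.mul_left_cancel hyz]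
  · intro x hx
    have hdiff : ∀ y : ZMod n, (∃ a b : ZMod n, s(y, 2 * y) = s(a, b) ∧ (x = a - b ∨ x = b - a)) ↔
        x = y ∨ x = -y := by
      intro y
      constructor
      · rintro ⟨a, b, hab, hx⟩
        rcases Sym2.eq_iff.mp hab with ⟨rfl, rfl⟩ | ⟨rfl, rfl⟩ <;> rcases hx with rfl | rfl
        · right; ring
        · left; ring
        · left; ring
        · right; ring
      · rintro (rfl | rfl)
        · exact ⟨x, 2 * x, rfl, Or.inr (by ring)⟩
        · exact ⟨y, 2 * y, rfl, Or.inl (by ring)⟩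
    obtain ⟨z, hz, hxz⟩ : ∃ z ∈ A, x = z ∨ x = -z := by
      rcases hcov x hx with h | h
      · exact ⟨x, h, Or.inl rfl⟩
      · exact ⟨-x, h, Or.inr (neg_neg x).symm⟩
    refine ⟨s(z, 2 * z), ⟨Finset.mem_image_of_mem _ hz, (hdiff z).mpr hxz⟩, ?_⟩
    rintro _ ⟨hs, hxs⟩
    obtain ⟨y, hy, rfl⟩ := Finset.mem_image.mp hs
    have hyz : y = z := by
      rcases (hdiff y).mp hxs with rfl | rfl <;> rcases hxz with h | h
      · exact h
      · exact absurd (h ▸ hy) (hneg z hz)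
      · exact absurd (h ▸ hz) (hneg y hy)
      · exact neg_inj.mp h
    rw [hyz]

theorem isSkolemStarter_image_of_halfSystem [DecidableEq (ZMod n)] [NeZero n] (hodd : Odd n)
    (hA : IsStarter n (A.image fun x => s(x, 2 * x)))
    (h0 : 0 ∉ A) (hcov : ∀ x ≠ 0, x ∈ A ∨ -x ∈ A) (hneg : ∀ x ∈ A, -x ∉ A) :
    IsSkolemStarter n (A.image fun x => s(x, 2 * x)) := by
  have hn2 := Nat.odd_iff.mp hodd
  have hcast : ∀ i ∈ Finset.Icc 1 ((n - 1) / 2), (i : ZMod n) ≠ 0 := by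
    intro i hi h
    rw [Finset.mem_Icc] at hi
    have := Nat.le_of_dvd (by omega) ((ZMod.natCast_eq_zero_iff i n).mp h)
    omega
  refine ⟨hA, fun i => if (i : ZMod n) ∈ A then ((i : ZMod n), 2 * (i : ZMod n))
    else (2 * -(i : ZMod n), -(i : ZMod n)), ?_, ?_⟩
  · ext s
    simp only [Finset.mem_image]
    constructor
    · rintro ⟨x, hx, rfl⟩
      have hx0 : x.val ≠ 0 := fun h => h0 ((ZMod.val_eq_zero x).mp h ▸ hx)
      have hlt := ZMod.val_lt x
      by_cases hle : x.val ≤ (n - 1) / 2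
      · refine ⟨x.val, Finset.mem_Icc.mpr ⟨by omega, hle⟩, ?_⟩
        simp [hx]
      · refine ⟨n - x.val, Finset.mem_Icc.mpr ⟨by omega, by omega⟩, ?_⟩
        have : ((n - x.val : ℕ) : ZMod n) = -x := by
          rw [Nat.cast_sub hlt.le]
          simp
        simp only [this, if_neg (hneg x hx), neg_neg]
        exact Sym2.eq_swap
    · rintro ⟨i, hi, rfl⟩
      by_cases hiA : (i : ZMod n) ∈ A
      · exact ⟨i, hiA, by simp [hiA]⟩
      · refine ⟨-i, (hcov _ (hcast i hi)).resolve_left hiA, ?_⟩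
        simp only [if_neg hiA]
        exact Sym2.eq_swap
  · intro i hi
    rw [Finset.mem_Icc] at hi
    by_cases hiA : (i : ZMod n) ∈ A
    · simp only [if_pos hiA]
      refine ⟨by ring, ?_⟩
      have h2i : (2 * (i : ZMod n)) = ((2 * i : ℕ) : ZMod n) := by push_cast; rfl
      rw [h2i, ZMod.val_natCast_of_lt (by omega), ZMod.val_natCast_of_lt (by omega)]
      omega
    · simp only [if_neg hiA]
      refine ⟨by ring, ?_⟩
      have h1i : -(i : ZMod n) = ((n - i : ℕ) : ZMod n) := by
        rw [Nat.cast_sub (by omega)]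
        simp
      have h2i : 2 * -(i : ZMod n) = ((n - 2 * i : ℕ) : ZMod n) := by
        rw [Nat.cast_sub (by omega)]
        simp
      rw [h2i, h1i, ZMod.val_natCast_of_lt (by omega), ZMod.val_natCast_of_lt (by omega)]
      omega

theorem isStrongStarter_image_of_halfSystem [DecidableEq (ZMod n)] (h3 : IsUnit (3 : ZMod n))
    (hA : IsStarter n (A.image fun x => s(x, 2 * x))) (h0 : 0 ∉ A) :
    IsStrongStarter n (A.image fun x => s(x, 2 * x)) := by
  have hsum : ∀ x a b : ZMod n, s(x, 2 * x) = s(a, b) → a + b = 3 * x := by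
    intro x a b hab
    rcases Sym2.eq_iff.mp hab with ⟨rfl, rfl⟩ | ⟨rfl, rfl⟩ <;> ring
  refine ⟨hA, ?_, ?_⟩
  · simp only [Finset.forall_mem_image]
    intro x hx a b hab h
    rw [hsum x a b hab] at h
    exact h0 (h3.mul_right_eq_zero.mp h ▸ hx)
  · simp only [Finset.forall_mem_image]
    intro x hx y hy a b c d hab hcd h
    rw [hsum x a b hab, hsum y c d hcd] at h
    rw [h3.mul_left_cancel h]

end HalfSystem

/-- Let `n ≥ 3` be an odd integer such that every prime divisor `p` of `n` satisfies
`p ≠ 3` and the multiplicative order of `2` modulo `p` is congruent to `2` modulo `4`.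
Then `ℤ_n` admits a strong Skolem starter. -/
theorem strong_skolem_starter_exists (n : ℕ) (hn : 3 ≤ n) (hodd : Odd n)
    (h : ∀ p : ℕ, p.Prime → p ∣ n → p ≠ 3 ∧ orderOf (2 : ZMod p) % 4 = 2) :
    ∃ S : Finset (Sym2 (ZMod n)), IsStrongStarter n S ∧ IsSkolemStarter n S := by
  classical
  have : NeZero n := ⟨by omega⟩
  have h2 : IsUnit (2 : ZMod n) := by
    exact_mod_cast (ZMod.isUnit_iff_coprime 2 n).mpr hodd.coprime_two_left
  have h3 : IsUnit (3 : ZMod n) := by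
    refine mod_cast (ZMod.isUnit_iff_coprime 3 n).mpr ?_
    exact (Nat.Prime.coprime_iff_not_dvd Nat.prime_three).mpr
      fun h3 => (h 3 Nat.prime_three h3).1 rfl
  obtain ⟨m, hm, hdvd⟩ := exists_odd_dvd_two_pow_add_one n (by omega) fun p hp hpn => (h p hp hpn).2
  have hpow : (2 : ZMod n) ^ m = -1 := by
    rw [← ZMod.intCast_zmod_eq_zero_iff_dvd] at hdvd
    push_cast at hdvd
    exact eq_neg_of_add_eq_zero_left hdvd
  obtain ⟨A, h0, hcov, hneg, hmul⟩ := exists_halfSystem hm hpow h2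
  have hA := isStarter_image_of_halfSystem h2 h0 hcov hneg hmul
  exact ⟨_, isStrongStarter_image_of_halfSystem h3 hA h0,
    isSkolemStarter_image_of_halfSystem hodd hA h0 hcov hneg⟩
end

section
/- Let n ≥ 3 be an odd integer. A strong cardioidal starter of order n exists if and only if every prime divisor p of n satisfies p ≠ 3 and the multiplicative order of 2 modulo p is congruent to 2 modulo 4. -/
theorem ZMod.isUnit_intCast_of_forall_prime {n : ℕ} {z : ℤ}
    (h : ∀ p : ℕ, p.Prime → p ∣ n → (z : ZMod p) ≠ 0) : IsUnit (z : ZMod n) := by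
  rw [ZMod.coe_int_isUnit_iff_isCoprime, Int.isCoprime_iff_gcd_eq_one]
  by_contra hg
  obtain ⟨p, hp, hpg⟩ := Nat.exists_prime_and_dvd hg
  have hpg' : (p : ℤ) ∣ ((Int.gcd n z : ℕ) : ℤ) := by exact_mod_cast hpg
  refine h p hp ?_ ((ZMod.intCast_zmod_eq_zero_iff_dvd _ _).2
    (hpg'.trans (Int.gcd_dvd_right _ _)))
  exact_mod_cast hpg'.trans (Int.gcd_dvd_left _ _)

theorem odd_orderOf_of_forall_pow_ne_neg_one {R : Type*} [Ring R] [NoZeroDivisors R] {b : R}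
    (hb : IsOfFinOrder b) (h : ∀ k : ℕ, b ^ k ≠ -1) : Odd (orderOf b) := by
  have hpos := hb.orderOf_pos
  rw [← Nat.not_even_iff_odd, even_iff_two_dvd]
  rintro ⟨j, hj⟩
  have hsq : (b ^ j) ^ 2 = 1 := by
    rw [← pow_mul, mul_comm, ← hj, pow_orderOf_eq_one]
  rcases sq_eq_one_iff.1 hsq with h1 | h1
  · have := Nat.le_of_dvd (by omega) (orderOf_dvd_of_pow_eq_one h1)
    omega
  · exact h j h1

theorem orderOf_mod_four_eq_two_iff {R : Type*} [Ring R] [Nontrivial R] [NoZeroDivisors R]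
    (hR : ringChar R ≠ 2) (a : R) : orderOf a % 4 = 2 ↔ Odd (orderOf (-a)) := by
  constructor
  · intro h
    obtain ⟨m, hm⟩ : ∃ m, orderOf a = 2 * m := ⟨orderOf a / 2, by omega⟩
    have hmodd : Odd m := Nat.odd_iff.2 (by omega)
    have hsq : (a ^ m) ^ 2 = 1 := by
      rw [← pow_mul, mul_comm, ← hm, pow_orderOf_eq_one]
    have ham : a ^ m = -1 := by
      refine (sq_eq_one_iff.1 hsq).resolve_left fun h1 => ?_
      have := Nat.le_of_dvd (by omega) (orderOf_dvd_of_pow_eq_one h1)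
      omega
    exact Odd.of_dvd_nat hmodd
      (orderOf_dvd_of_pow_eq_one (by rw [hmodd.neg_pow, ham, neg_neg]))
  · intro h
    have h2 : orderOf (-1 : R) = 2 := by rw [orderOf_neg_one, if_neg hR]
    have : orderOf a = 2 * orderOf (-a) := by
      rw [← h2, ← (Commute.neg_one_left (-a)).orderOf_mul_eq_mul_orderOf_of_coprime
        (by rw [h2]; exact Nat.coprime_two_left.2 h)]
      simp
    obtain ⟨k, hk⟩ := h
    omega

/-- A unit of finite order whose powers never satisfy `u ^ k * x = -(u ^ l * x)` for `x ≠ 0`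
admits a set of representatives for `x ↦ -x` that is stable under multiplication by `u`. -/
theorem exists_mul_stable_half {R : Type*} [CommRing R] (f : R → ℕ) (hf : Function.Injective f)
    {u : R} (hu : IsOfFinOrder u)
    (h : ∀ (k l : ℕ) (x : R), x ≠ 0 → u ^ k * x ≠ -(u ^ l * x)) :
    ∃ D : R → Prop, (∀ x, D (u * x) ↔ D x) ∧ ∀ x, x ≠ 0 → (D (-x) ↔ ¬ D x) := by
  let g : R → ℕ := fun x => sInf (Set.range fun k : ℕ => f (u ^ k * x))
  have hg (x : R) : ∃ k : ℕ, f (u ^ k * x) = g x := Nat.sInf_mem (Set.range_nonempty _)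
  obtain ⟨N, hN, huN⟩ := isOfFinOrder_iff_pow_eq_one.1 hu
  have hgu (x : R) : g (u * x) = g x := by
    refine congrArg sInf (Set.ext fun m => ?_)
    constructor
    · rintro ⟨k, rfl⟩
      exact ⟨k + 1, by simp only [pow_succ, mul_assoc]⟩
    · rintro ⟨k, rfl⟩
      refine ⟨k + (N - 1), ?_⟩
      dsimp only
      rw [← mul_assoc, ← pow_succ, show k + (N - 1) + 1 = k + N by omega, pow_add, huN, mul_one]
  refine ⟨fun x => g x < g (-x), fun x => ?_, fun x hx => ?_⟩
  · simp only [← mul_neg, hgu]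
  · have hne : g x ≠ g (-x) := by
      intro heq
      obtain ⟨k, hk⟩ := hg x
      obtain ⟨l, hl⟩ := hg (-x)
      exact h k l x hx (by rw [← mul_neg]; exact hf (by rw [hk, hl, heq]))
    simp only [neg_neg]
    omega

theorem exists_strong_cardioidal_of_half {n : ℕ} [NeZero n] (h2 : IsUnit (2 : ZMod n))
    (h3 : IsUnit (3 : ZMod n)) (D : ZMod n → Prop) (hD : ∀ x, D (-2 * x) ↔ D x)
    (hneg : ∀ x, x ≠ 0 → (D (-x) ↔ ¬ D x)) :
    ∃ S : Finset (Sym2 (ZMod n)), IsStrongStarter n S ∧ IsCardioidal n S := by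
  classical
  have hD2 (x : ZMod n) (hx : x ≠ 0) : D (2 * x) ↔ ¬ D x := by
    rw [← hneg x hx, ← hD (-x), neg_mul_neg]
  let S := (Finset.univ.filter fun x : ZMod n => x ≠ 0 ∧ D x).image fun x => s(x, 2 * x)
  have hS (s) : s ∈ S ↔ ∃ x, (x ≠ 0 ∧ D x) ∧ s(x, 2 * x) = s := by simp [S]
  refine ⟨S, ⟨⟨?_, ?_, ?_, ?_⟩, ?_, ?_⟩, ?_⟩
  · intro s hs
    obtain ⟨x, ⟨hx, -⟩, rfl⟩ := (hS s).1 hs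
    rw [Sym2.mk_isDiag_iff]
    exact fun h => hx (by linear_combination -h)
  · intro s hs y hy
    obtain ⟨x, ⟨hx, -⟩, rfl⟩ := (hS s).1 hs
    rcases Sym2.mem_iff.1 hy with rfl | rfl
    · exact hx
    · rwa [Ne, h2.mul_right_eq_zero]
  · intro x hx
    have key : ∃ y, (y ≠ 0 ∧ D y) ∧ (x = y ∨ x = 2 * y) := by
      by_cases hDx : D x
      · exact ⟨x, ⟨hx, hDx⟩, Or.inl rfl⟩
      · obtain ⟨y, rfl⟩ : ∃ y, x = 2 * y := h2.dvd
        have hy : y ≠ 0 := by rintro rfl; simp at hx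
        exact ⟨y, ⟨hy, by rwa [hD2 y hy, not_not] at hDx⟩, Or.inr rfl⟩
    obtain ⟨y, hy, hxy⟩ := key
    refine ⟨s(y, 2 * y), ⟨(hS _).2 ⟨y, hy, rfl⟩, Sym2.mem_iff.2 hxy⟩, ?_⟩
    rintro s ⟨hs, hxs⟩
    obtain ⟨z, hz, rfl⟩ := (hS s).1 hs
    rcases hxy with rfl | rfl <;> rcases Sym2.mem_iff.1 hxs with h | h
    · rw [h]
    · exact absurd hz.2 ((hD2 z hz.1).1 (h ▸ hy.2))
    · exact absurd hy.2 ((hD2 y hy.1).1 (h ▸ hz.2))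
    · rw [h2.mul_left_cancel h]
  · intro x hx
    have key : ∃ y, (y ≠ 0 ∧ D y) ∧ (x = y ∨ x = -y) := by
      by_cases hDx : D x
      · exact ⟨x, ⟨hx, hDx⟩, Or.inl rfl⟩
      · exact ⟨-x, ⟨neg_ne_zero.2 hx, (hneg x hx).2 hDx⟩, Or.inr (neg_neg x).symm⟩
    obtain ⟨y, hy, hxy⟩ := key
    refine ⟨s(y, 2 * y), ⟨(hS _).2 ⟨y, hy, rfl⟩, y, 2 * y, rfl, ?_⟩, ?_⟩
    · rcases hxy with rfl | rfl
      · right; ring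
      · left; ring
    · rintro s ⟨hs, a, b, hab, hxab⟩
      obtain ⟨z, hz, rfl⟩ := (hS s).1 hs
      have hxz : x = z ∨ x = -z := by
        rcases Sym2.eq_iff.1 hab with ⟨rfl, rfl⟩ | ⟨rfl, rfl⟩ <;> rcases hxab with rfl | rfl
        · right; ring
        · left; ring
        · left; ring
        · right; ring
      rcases hxy with rfl | rfl <;> rcases hxz with h | h
      · rw [h]
      · exact absurd hz.2 ((hneg z hz.1).1 (h ▸ hy.2))
      · exact absurd hy.2 ((hneg y hy.1).1 (h ▸ hz.2))
      · rw [neg_injective h]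
  · intro s hs a b hab
    obtain ⟨z, hz, rfl⟩ := (hS s).1 hs
    have : a + b = 3 * z := by
      rcases Sym2.eq_iff.1 hab with ⟨rfl, rfl⟩ | ⟨rfl, rfl⟩ <;> ring
    rw [this, Ne, h3.mul_right_eq_zero]
    exact hz.1
  · intro s hs t ht a b c d hab hcd h
    obtain ⟨y, hy, rfl⟩ := (hS s).1 hs
    obtain ⟨z, hz, rfl⟩ := (hS t).1 ht
    have h1 : a + b = 3 * y := by
      rcases Sym2.eq_iff.1 hab with ⟨rfl, rfl⟩ | ⟨rfl, rfl⟩ <;> ring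
    have h1' : c + d = 3 * z := by
      rcases Sym2.eq_iff.1 hcd with ⟨rfl, rfl⟩ | ⟨rfl, rfl⟩ <;> ring
    rw [h1, h1'] at h
    rw [h3.mul_left_cancel h]
  · intro s hs
    obtain ⟨x, hx, rfl⟩ := (hS s).1 hs
    exact ⟨x, hx.1, rfl⟩

/-- For each `x ≠ 0`, a cardioidal starter contains the pair generated by `x` or by `-x`. -/
theorem IsCardioidal.pair_mem_or {n : ℕ} {S : Finset (Sym2 (ZMod n))} (hS : IsStarter n S)
    (hc : IsCardioidal n S) {x : ZMod n} (hx : x ≠ 0) :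
    s(x, 2 * x) ∈ S ∨ s(-x, 2 * -x) ∈ S := by
  obtain ⟨s, ⟨hs, a, b, hab, hxab⟩, -⟩ := hS.2.2.2 x hx
  obtain ⟨z, -, rfl⟩ := hc s hs
  have hxz : x = z ∨ -x = z := by
    rcases Sym2.eq_iff.1 hab with ⟨rfl, rfl⟩ | ⟨rfl, rfl⟩ <;> rcases hxab with rfl | rfl
    · right; ring
    · left; ring
    · left; ring
    · right; ring
  rcases hxz with rfl | rfl
  · exact Or.inl hs
  · exact Or.inr hs

theorem IsStrongStarter.three_mul_ne_zero {n : ℕ} {S : Finset (Sym2 (ZMod n))}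
    (hS : IsStrongStarter n S) (hc : IsCardioidal n S) {x : ZMod n} (hx : x ≠ 0) :
    3 * x ≠ 0 := by
  intro h
  rcases hc.pair_mem_or hS.1 hx with hm | hm
  · exact hS.2.1 _ hm _ _ rfl (by linear_combination h)
  · exact hS.2.1 _ hm _ _ rfl (by linear_combination -h)

theorem IsStrongStarter.pair_neg_notMem {n : ℕ} {S : Finset (Sym2 (ZMod n))}
    (hS : IsStrongStarter n S) (hc : IsCardioidal n S) (h2 : IsUnit (2 : ZMod n)) {x : ZMod n}
    (hx : x ≠ 0) (hm : s(x, 2 * x) ∈ S) : s(-x, 2 * -x) ∉ S := by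
  intro hm'
  have h := (hS.1.2.2.2 x hx).unique ⟨hm, _, _, rfl, Or.inr (by ring)⟩
    ⟨hm', _, _, rfl, Or.inl (by ring)⟩
  rcases Sym2.eq_iff.1 h with ⟨h, -⟩ | ⟨h, -⟩
  · exact hx (h2.mul_right_eq_zero.1 (by linear_combination h))
  · exact hS.three_mul_ne_zero hc hx (by linear_combination h)

theorem IsStrongStarter.pair_neg_two_mul_mem {n : ℕ} {S : Finset (Sym2 (ZMod n))}
    (hS : IsStrongStarter n S) (hc : IsCardioidal n S) (h2 : IsUnit (2 : ZMod n)) {x : ZMod n}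
    (hx : x ≠ 0) (hm : s(x, 2 * x) ∈ S) : s(-2 * x, 2 * (-2 * x)) ∈ S := by
  have h2x : 2 * x ≠ 0 := by rwa [Ne, h2.mul_right_eq_zero]
  rw [neg_mul]
  refine (hc.pair_mem_or hS.1 h2x).resolve_left fun hm' => ?_
  have h := (hS.1.2.2.1 _ h2x).unique ⟨hm, Sym2.mem_mk_right _ _⟩
    ⟨hm', Sym2.mem_mk_left _ _⟩
  rcases Sym2.eq_iff.1 h with ⟨h, -⟩ | ⟨h, -⟩
  · exact hx (by linear_combination -h)
  · exact hS.three_mul_ne_zero hc hx (by linear_combination -h)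

theorem IsStrongStarter.neg_two_pow_mul_ne_neg {n : ℕ} {S : Finset (Sym2 (ZMod n))}
    (hS : IsStrongStarter n S) (hc : IsCardioidal n S) (h2 : IsUnit (2 : ZMod n)) {x : ZMod n}
    (hx : x ≠ 0) (k : ℕ) : (-2) ^ k * x ≠ -x := by
  have main (y : ZMod n) (hy : y ≠ 0) (hm : s(y, 2 * y) ∈ S) : (-2) ^ k * y ≠ -y := by
    have hk : s((-2) ^ k * y, 2 * ((-2) ^ k * y)) ∈ S := by
      induction k with
      | zero => simpa using hm
      | succ k ih =>
        rw [pow_succ', mul_assoc]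
        exact hS.pair_neg_two_mul_mem hc h2
          (by rwa [Ne, (h2.neg.pow k).mul_right_eq_zero]) ih
    intro h
    rw [h] at hk
    exact hS.pair_neg_notMem hc h2 hy hm hk
  rcases hc.pair_mem_or hS.1 hx with hm | hm
  · exact main x hx hm
  · intro h
    exact main (-x) (neg_ne_zero.2 hx) hm (by linear_combination -h)

/-- A strong cardioidal starter of order `n` exists iff every prime divisor `p` of `n`
satisfies `p ≠ 3` and the multiplicative order of `2` modulo `p` is `≡ 2 (mod 4)`. -/
theorem strong_cardioidal_starter_iff (n : ℕ) (hn : 3 ≤ n) (hodd : Odd n) :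
    (∃ S : Finset (Sym2 (ZMod n)), IsStrongStarter n S ∧ IsCardioidal n S) ↔
      (∀ p : ℕ, p.Prime → p ∣ n → p ≠ 3 ∧ orderOf (2 : ZMod p) % 4 = 2) := by
  have : NeZero n := ⟨by omega⟩
  have h2 : IsUnit (2 : ZMod n) := by
    exact_mod_cast (ZMod.isUnit_iff_coprime 2 n).2 (Nat.coprime_two_left.2 hodd)
  have hchar (p : ℕ) (hp : p ∣ n) : ringChar (ZMod p) ≠ 2 := by
    rw [ZMod.ringChar_zmod_n]
    rintro rfl
    exact (Nat.not_even_iff_odd.2 hodd) (even_iff_two_dvd.2 hp)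
  constructor
  · rintro ⟨S, hS, hc⟩ p hp hpn
    have : Fact p.Prime := ⟨hp⟩
    obtain ⟨m, rfl⟩ := hpn
    have hm : m ≠ 0 := by rintro rfl; omega
    have hmx (z : ℤ) : (z : ZMod p) = 0 ↔ (z : ZMod (p * m)) * (m : ZMod (p * m)) = 0 := by
      rw [ZMod.intCast_zmod_eq_zero_iff_dvd, ← Int.cast_natCast (R := ZMod (p * m)) m,
        ← Int.cast_mul, ZMod.intCast_zmod_eq_zero_iff_dvd, Nat.cast_mul,
        mul_dvd_mul_iff_right (by exact_mod_cast hm)]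
    have hx : (m : ZMod (p * m)) ≠ 0 := by
      have := (hmx 1).not.1 (by simp)
      simpa using this
    constructor
    · rintro rfl
      refine hS.three_mul_ne_zero hc hx ?_
      have := (hmx 3).1 (mod_cast ZMod.natCast_self 3)
      simpa using this
    · have h2p : (2 : ZMod p) ≠ 0 := Ring.two_ne_zero (hchar p (dvd_mul_right _ _))
      rw [orderOf_mod_four_eq_two_iff (hchar p (dvd_mul_right _ _))]
      refine odd_orderOf_of_forall_pow_ne_neg_one
        (IsUnit.mk0 _ (neg_ne_zero.2 h2p)).isOfFinOrder fun k hk => ?_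
      apply hS.neg_two_pow_mul_ne_neg hc h2 hx k
      have := (hmx ((-2) ^ k + 1)).1 (by push_cast; rw [hk]; ring)
      push_cast at this
      linear_combination this
  · intro h
    have h3 : IsUnit (3 : ZMod n) := by
      refine mod_cast ZMod.isUnit_intCast_of_forall_prime (z := 3) fun p hp hpn h0 => ?_
      rw [ZMod.intCast_zmod_eq_zero_iff_dvd] at h0
      exact (h p hp hpn).1 ((Nat.prime_dvd_prime_iff_eq hp Nat.prime_three).1 (mod_cast h0))
    have hunit (k l : ℕ) : IsUnit ((-2 : ZMod n) ^ k + (-2) ^ l) := by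
      refine mod_cast ZMod.isUnit_intCast_of_forall_prime (z := (-2) ^ k + (-2) ^ l)
        fun p hp hpn h0 => ?_
      have : Fact p.Prime := ⟨hp⟩
      have ho := (orderOf_mod_four_eq_two_iff (hchar p hpn) _).1 (h p hp hpn).2
      push_cast at h0
      have hpow (j : ℕ) : ((-2 : ZMod p) ^ j) ^ orderOf (-2 : ZMod p) = 1 := by
        rw [← pow_mul, mul_comm, pow_mul, pow_orderOf_eq_one, one_pow]
      have h1 := hpow k
      rw [eq_neg_of_add_eq_zero_left h0, ho.neg_pow, hpow l] at h1
      exact Ring.neg_one_ne_one_of_char_ne_two (hchar p hpn) h1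
    obtain ⟨D, hD, hneg⟩ := exists_mul_stable_half (ZMod.val (n := n)) (ZMod.val_injective n)
      h2.neg.isOfFinOrder fun k l x hx hkl =>
        hx ((hunit k l).mul_right_eq_zero.1 (by linear_combination hkl))
    exact exists_strong_cardioidal_of_half h2 h3 D hD hneg
end

section
/- Let n ≥ 3 be odd and let S be a cardioidal starter of order n. Then S is a strong starter if and only if 3 does not divide n. -/
theorem add_eq_add_of_sym2_eq {M : Type*} [AddCommMagma M] {a b c d : M}
    (h : s(a, b) = s(c, d)) : a + b = c + d := by
  rcases Sym2.eq_iff.mp h with ⟨rfl, rfl⟩ | ⟨rfl, rfl⟩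
  · rfl
  · exact add_comm _ _

theorem ZMod.isUnit_three_iff {n : ℕ} : IsUnit (3 : ZMod n) ↔ ¬ 3 ∣ n :=
  (ZMod.isUnit_iff_coprime 3 n).trans Nat.prime_three.coprime_iff_not_dvd

theorem ZMod.exists_ne_zero_three_mul_eq_zero {n : ℕ} (hn : n ≠ 0) (h : 3 ∣ n) :
    ∃ k : ZMod n, k ≠ 0 ∧ 3 * k = 0 := by
  obtain ⟨m, rfl⟩ := h
  refine ⟨(m : ZMod (3 * m)), fun hm => ?_, ?_⟩
  · have := Nat.le_of_dvd (by omega) ((ZMod.natCast_eq_zero_iff m (3 * m)).mp hm)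
    omega
  · exact_mod_cast ZMod.natCast_self (3 * m)

/-- The pair of a cardioidal starter with difference `k` is `{k, 2k}` or `{-k, -2k}`. -/
theorem IsCardioidal.exists_mem_of_ne_zero {n : ℕ} {S : Finset (Sym2 (ZMod n))} (hS : IsStarter n S)
    (hC : IsCardioidal n S) {k : ZMod n} (hk : k ≠ 0) :
    ∃ x : ZMod n, s(x, 2 * x) ∈ S ∧ (x = k ∨ x = -k) := by
  obtain ⟨_, ⟨hs, a, b, hab, hd⟩, -⟩ := hS.2.2.2 k hk
  obtain ⟨x, -, rfl⟩ := hC _ hs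
  refine ⟨x, hs, ?_⟩
  rcases Sym2.eq_iff.mp hab with ⟨rfl, rfl⟩ | ⟨rfl, rfl⟩ <;> grind

/-- A cardioidal starter of order `n` is strong iff `3` does not divide `n`. -/
theorem cardioidal_strong_iff_not_three_dvd (n : ℕ) (hn : 3 ≤ n) (hodd : Odd n)
    (S : Finset (Sym2 (ZMod n))) (hS : IsStarter n S) (hC : IsCardioidal n S) :
    IsStrongStarter n S ↔ ¬ (3 ∣ n) := by
  constructor
  · rintro ⟨-, hsum, -⟩ h3
    obtain ⟨k, hk, hk3⟩ := ZMod.exists_ne_zero_three_mul_eq_zero (by omega) h3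
    obtain ⟨x, hx, hxk⟩ := hC.exists_mem_of_ne_zero hS hk
    exact hsum _ hx x (2 * x) rfl (by grind)
  · intro h3
    have hu := ZMod.isUnit_three_iff.mpr h3
    have hpair : ∀ {x a b : ZMod n}, s(x, 2 * x) = s(a, b) → a + b = 3 * x := fun h =>
      (add_eq_add_of_sym2_eq h).symm.trans (by ring)
    refine ⟨hS, fun s hs a b hab => ?_, fun s hs t ht a b c d hab hcd hsum => ?_⟩
    · obtain ⟨x, hx, rfl⟩ := hC s hs
      rw [hpair hab]
      exact fun h => hx (hu.mul_right_eq_zero.mp h)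
    · obtain ⟨x, -, rfl⟩ := hC s hs
      obtain ⟨y, -, rfl⟩ := hC t ht
      rw [hpair hab, hpair hcd] at hsum
      rw [hu.mul_left_cancel hsum]
end

section
/- Let n ≥ 3 be odd with 3 not dividing n, and let S be a cardioidal starter of order n. Then S is skew. -/
/-- If `s = {z, 2z}` and `3` is cancellable, then `3y` is up to sign the sum of `s`
iff `y` is up to sign its difference. -/
theorem cardioidal_pair_sum_iff_diff {R : Type*} [CommRing R] (h3 : IsUnit (3 : R)) (y z : R) :
    (∃ a b : R, s(z, 2 * z) = s(a, b) ∧ (3 * y = a + b ∨ 3 * y = -(a + b))) ↔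
      ∃ a b : R, s(z, 2 * z) = s(a, b) ∧ (y = a - b ∨ y = b - a) := by
  have cancel : ∀ {u v : R}, 3 * u = 3 * v → u = v := fun h => h3.mul_left_cancel h
  constructor
  · rintro ⟨a, b, hab, h⟩
    have hsum : a + b = 3 * z := by
      rcases Sym2.eq_iff.mp hab with ⟨rfl, rfl⟩ | ⟨rfl, rfl⟩ <;> ring
    refine ⟨z, 2 * z, rfl, ?_⟩
    rcases h with h | h
    · exact Or.inr (cancel (by linear_combination h + hsum))
    · exact Or.inl (cancel (by linear_combination h - hsum))
  · rintro ⟨a, b, hab, h⟩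
    refine ⟨z, 2 * z, rfl, ?_⟩
    have hy : y = z ∨ y = -z := by
      rcases Sym2.eq_iff.mp hab with ⟨rfl, rfl⟩ | ⟨rfl, rfl⟩ <;> rcases h with h | h
      · exact Or.inr (by linear_combination h)
      · exact Or.inl (by linear_combination h)
      · exact Or.inl (by linear_combination h)
      · exact Or.inr (by linear_combination h)
    rcases hy with rfl | rfl
    · exact Or.inl (by ring)
    · exact Or.inr (by ring)

/-- A cardioidal starter of order `n` with `3 ∤ n` is skew. -/
theorem cardioidal_starter_skew (n : ℕ) (hn : 3 ≤ n) (hodd : Odd n) (h3 : ¬ (3 ∣ n))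
    (S : Finset (Sym2 (ZMod n))) (hS : IsStarter n S) (hC : IsCardioidal n S) :
    IsSkewStarter n S := by
  have hunit : IsUnit (3 : ZMod n) := by
    have := (ZMod.isUnit_iff_coprime 3 n).mpr ((Nat.Prime.coprime_iff_not_dvd Nat.prime_three).mpr h3)
    exact_mod_cast this
  refine ⟨hS, fun x hx => ?_⟩
  obtain ⟨y, rfl⟩ : ∃ y, x = 3 * y := hunit.dvd
  have hy : y ≠ 0 := right_ne_zero_of_mul hx
  refine (existsUnique_congr fun s => and_congr_right fun hs => ?_).mpr (hS.2.2.2 y hy)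
  obtain ⟨z, -, rfl⟩ := hC s hs
  exact cardioidal_pair_sum_iff_diff hunit y z
end

section
/- Let n ≥ 3 be odd. Every cardioidal starter of order n is a Skolem starter. -/
/-- In a cardioidal starter, every nonzero `d` is the difference of the pair `{d, 2d}` or of
the pair `{-2d, -d}`. -/
theorem IsCardioidal.mem_or_mem {n : ℕ} {S : Finset (Sym2 (ZMod n))} (hS : IsStarter n S)
    (hC : IsCardioidal n S) {d : ZMod n} (hd : d ≠ 0) :
    s(d, 2 * d) ∈ S ∨ s(-(2 * d), -d) ∈ S := by
  obtain ⟨s, ⟨hs, a, b, hab, hdiff⟩, -⟩ := hS.2.2.2 d hd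
  obtain ⟨x, -, hx⟩ := hC s hs
  have hxd : x = d ∨ x = -d := by
    rcases Sym2.eq_iff.1 (hab.symm.trans hx) with ⟨rfl, rfl⟩ | ⟨rfl, rfl⟩ <;>
      rcases hdiff with rfl | rfl <;> first | (left; ring; done) | (right; ring)
  rcases hxd with rfl | rfl
  · exact Or.inl (hx ▸ hs)
  · right
    rwa [Sym2.eq_swap, ← mul_neg, ← hx]

/-- Every cardioidal starter of order `n` is a Skolem starter. -/
theorem cardioidal_starter_skolem (n : ℕ) (hn : 3 ≤ n) (hodd : Odd n)
    (S : Finset (Sym2 (ZMod n))) (hS : IsStarter n S) (hC : IsCardioidal n S) :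
    IsSkolemStarter n S := by
  have : NeZero n := ⟨by omega⟩
  obtain ⟨m, hm⟩ := hodd
  have cast_ne_zero : ∀ i ∈ Finset.Icc 1 ((n - 1) / 2), (i : ZMod n) ≠ 0 := by
    intro i hi h
    rw [Finset.mem_Icc] at hi
    have := Nat.le_of_dvd (by omega) ((ZMod.natCast_eq_zero_iff i n).1 h)
    omega
  have exists_pair : ∀ i : ℕ, ∃ p : ZMod n × ZMod n, i ∈ Finset.Icc 1 ((n - 1) / 2) →
      s(p.1, p.2) ∈ S ∧ p.2 - p.1 = (i : ZMod n) ∧ p.1.val < p.2.val := by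
    intro i
    by_cases hi : i ∈ Finset.Icc 1 ((n - 1) / 2)
    swap
    · exact ⟨0, fun h => absurd h hi⟩
    have hi' := Finset.mem_Icc.1 hi
    rcases hC.mem_or_mem hS (cast_ne_zero i hi) with h | h
    · refine ⟨((i : ZMod n), 2 * (i : ZMod n)), fun _ => ⟨h, by ring, ?_⟩⟩
      have h2 : (2 * (i : ZMod n)) = ((2 * i : ℕ) : ZMod n) := by push_cast; rfl
      rw [h2, ZMod.val_natCast_of_lt (by omega), ZMod.val_natCast_of_lt (by omega)]
      omega
    · refine ⟨(-(2 * (i : ZMod n)), -(i : ZMod n)), fun _ => ⟨h, by ring, ?_⟩⟩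
      have h1 : -(i : ZMod n) = ((n - i : ℕ) : ZMod n) := by
        rw [Nat.cast_sub (by omega)]; simp
      have h2 : -(2 * (i : ZMod n)) = ((n - 2 * i : ℕ) : ZMod n) := by
        rw [Nat.cast_sub (by omega)]; simp
      rw [h1, h2, ZMod.val_natCast_of_lt (by omega), ZMod.val_natCast_of_lt (by omega)]
      omega
  choose st hst using exists_pair
  refine ⟨hS, st, ?_, fun i hi => (hst i hi).2⟩
  ext s
  rw [Finset.mem_image]
  constructor
  · intro hs
    obtain ⟨x, hx0, hx⟩ := hC s hs
    obtain ⟨i, hi, hix⟩ : ∃ i ∈ Finset.Icc 1 ((n - 1) / 2),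
        (i : ZMod n) = x ∨ (i : ZMod n) = -x := by
      have hpos : 0 < x.val := ZMod.val_pos.2 hx0
      have hlt := ZMod.val_lt x
      by_cases h : x.val ≤ m
      · exact ⟨x.val, Finset.mem_Icc.2 (by omega), Or.inl (ZMod.natCast_zmod_val x)⟩
      · refine ⟨n - x.val, Finset.mem_Icc.2 (by omega), Or.inr ?_⟩
        rw [Nat.cast_sub hlt.le]; simp
    refine ⟨i, hi, (hS.2.2.2 i (cast_ne_zero i hi)).unique
      ⟨(hst i hi).1, _, _, rfl, Or.inr (hst i hi).2.1.symm⟩ ⟨hs, x, 2 * x, hx, ?_⟩⟩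
    rcases hix with h | h
    · right; rw [h]; ring
    · left; rw [h]; ring
  · rintro ⟨i, hi, rfl⟩
    exact (hst i hi).1
end

section
/- Let p be an odd prime such that the multiplicative order of 2 modulo p is congruent to 2 modulo 4. Then p ≡ 1 (mod 8) or p ≡ 3 (mod 8). -/
/-- An element one of whose odd powers is `1` is a square. -/
theorem isSquare_of_pow_eq_one_of_odd {M : Type*} [Monoid M] {a : M} {m : ℕ} (hm : Odd m)
    (h : a ^ m = 1) : IsSquare a := by
  have hs : IsSquare (a ^ (m + 1)) := hm.add_one.isSquare_pow a
  rwa [pow_succ, h, one_mul] at hs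

/-- If `a` has order `2 * m` with `m ≠ 0` in a ring without zero divisors, then `a ^ m = -1`. -/
theorem pow_eq_neg_one_of_orderOf_eq_two_mul {R : Type*} [Ring R] [NoZeroDivisors R] {a : R}
    {m : ℕ} (hm : m ≠ 0) (h : orderOf a = 2 * m) : a ^ m = -1 := by
  have hsq : (a ^ m) ^ 2 = 1 := by rw [← pow_mul, mul_comm, ← h, pow_orderOf_eq_one]
  refine (sq_eq_one_iff.mp hsq).resolve_left ?_
  exact pow_ne_one_of_lt_orderOf hm (by lia)

/-- If `p` is an odd prime and the multiplicative order of `2` modulo `p` is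
congruent to `2` modulo `4`, then `p ≡ 1 (mod 8)` or `p ≡ 3 (mod 8)`. -/
theorem mod_eight_of_orderOf_two_mod_four (p : ℕ) (hp : p.Prime) (hodd : Odd p)
    (h : orderOf (2 : ZMod p) % 4 = 2) :
    p % 8 = 1 ∨ p % 8 = 3 := by
  have : Fact p.Prime := ⟨hp⟩
  have hp2 : p ≠ 2 := by rintro rfl; exact absurd hodd (by decide)
  obtain ⟨m, hm⟩ : ∃ m, orderOf (2 : ZMod p) = 2 * m := ⟨orderOf (2 : ZMod p) / 2, by lia⟩
  have hmodd : Odd m := Nat.odd_iff.mpr (by lia)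
  refine (ZMod.exists_sq_eq_neg_two_iff hp2).mp (isSquare_of_pow_eq_one_of_odd hmodd ?_)
  rw [hmodd.neg_pow, pow_eq_neg_one_of_orderOf_eq_two_mul hmodd.pos.ne' hm, neg_neg]
end

section
/- Let p be a prime such that the multiplicative order of 2 modulo p is congruent to 2 modulo 4, and let n = p^k for some positive integer k. Then there exists an odd positive integer λ with 2^λ ≡ −1 (mod n), and the multiplicative order of 2 modulo n is congruent to 2 modulo 4. -/
/-- If some odd power of `x` is `-1 ≠ 1`, then the order of `x` is congruent to `2` modulo `4`. -/
theorem orderOf_mod_four_of_pow_odd_eq_neg_one {R : Type*} [Ring R] (hR : (-1 : R) ≠ 1)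
    {x : R} {l : ℕ} (hl : Odd l) (h : x ^ l = -1) : orderOf x % 4 = 2 := by
  have hdvd : orderOf x ∣ 2 * l :=
    orderOf_dvd_of_pow_eq_one (by rw [mul_comm, pow_mul, h, neg_one_sq])
  have heven : ¬ Odd (orderOf x) := fun hodd => hR <| by
    rw [← h]
    exact orderOf_dvd_iff_pow_eq_one.mp ((Nat.coprime_two_right.mpr hodd).dvd_of_dvd_mul_left hdvd)
  have hfour : ¬ 4 ∣ orderOf x := fun h4 => by
    have := h4.trans hdvd
    obtain ⟨t, rfl⟩ := hl
    omega
  rw [Nat.not_odd_iff] at heven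
  omega

/-- In a domain, an element of order congruent to `2` modulo `4` has an odd power equal to `-1`. -/
theorem exists_odd_pow_eq_neg_one_of_orderOf_mod_four {R : Type*} [Ring R] [NoZeroDivisors R]
    {x : R} (h : orderOf x % 4 = 2) : ∃ l : ℕ, Odd l ∧ x ^ l = -1 := by
  refine ⟨orderOf x / 2, Nat.odd_iff.mpr (by omega), ?_⟩
  have hsq : (x ^ (orderOf x / 2)) ^ 2 = 1 := by
    rw [← pow_mul, Nat.div_mul_cancel (by omega), pow_orderOf_eq_one]
  exact (sq_eq_one_iff.mp hsq).resolve_left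
    (pow_ne_one_of_lt_orderOf (by omega) (by omega))

/-- A congruence `a ^ m ≡ -1` modulo an odd prime `p` lifts to `p ^ (j + 1)`. -/
theorem ZMod.pow_mul_prime_pow_eq_neg_one {p : ℕ} (hp : Odd p) {a : ℤ} {m : ℕ}
    (h : (a : ZMod p) ^ m = -1) (j : ℕ) :
    (a : ZMod (p ^ (j + 1))) ^ (m * p ^ j) = -1 := by
  have hdvd : (p : ℤ) ∣ a ^ m - (-1) := by
    rw [← ZMod.intCast_zmod_eq_zero_iff_dvd]
    push_cast
    rw [h, sub_self]
  have hlift := dvd_sub_pow_of_dvd_sub hdvd j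
  rw [hp.pow.neg_one_pow, ← pow_mul] at hlift
  have hzero := (ZMod.intCast_zmod_eq_zero_iff_dvd _ (p ^ (j + 1))).mpr (by exact_mod_cast hlift)
  push_cast at hzero
  exact sub_eq_zero.mp (by simpa using hzero)

/-- Let `p` be a prime with `ord_p(2) ≡ 2 (mod 4)` and `n = p ^ k`, `k ≥ 1`.
Then `-1` is an odd power of `2` modulo `n`, and `ord_n(2) ≡ 2 (mod 4)`. -/
theorem neg_one_odd_power_of_two_prime_power (p k n : ℕ) (hp : p.Prime)
    (h2 : orderOf (2 : ZMod p) % 4 = 2) (hk : 0 < k) (hn : n = p ^ k) :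
    (∃ l : ℕ, Odd l ∧ 0 < l ∧ (2 : ZMod n) ^ l = -1) ∧
      orderOf (2 : ZMod n) % 4 = 2 := by
  have := Fact.mk hp
  have hp2 : p ≠ 2 := by
    rintro rfl
    have h0 : (2 : ZMod 2) = 0 := rfl
    simp [h0] at h2
  have hodd : Odd p := hp.odd_of_ne_two hp2
  obtain ⟨m, hm, hpow⟩ := exists_odd_pow_eq_neg_one_of_orderOf_mod_four h2
  obtain ⟨j, rfl⟩ := Nat.exists_eq_succ_of_ne_zero hk.ne'
  subst hn
  have hl : Odd (m * p ^ j) := hm.mul hodd.pow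
  have hneg : (2 : ZMod (p ^ (j + 1))) ^ (m * p ^ j) = -1 := by
    exact_mod_cast ZMod.pow_mul_prime_pow_eq_neg_one (a := 2) hodd (by exact_mod_cast hpow) j
  have : Fact (2 < p ^ (j + 1)) :=
    ⟨(lt_of_le_of_ne hp.two_le hp2.symm).trans_le (Nat.le_self_pow (by omega) p)⟩
  exact ⟨⟨_, hl, hl.pos, hneg⟩,
    orderOf_mod_four_of_pow_odd_eq_neg_one ZMod.neg_one_ne_one hl hneg⟩
end

section
/- Let n > 1 be an integer all of whose prime divisors p satisfy that the multiplicative order of 2 modulo p is congruent to 2 modulo 4. Then the set G_n of units of ℤ_n admits a partition A into unordered pairs of the form {x, 2x (mod n)}, such that the set of differences {±x : {x, 2x} is a pair of A} equals G_n. -/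
/-- If every prime factor of `n` divides some `a ^ k + 1` with `k` odd, then so does `n`. -/
theorem exists_odd_dvd_pow_add_one {a : ℤ} {n : ℕ} (hn : n ≠ 0) (hodd : Odd n)
    (h : ∀ p : ℕ, p.Prime → p ∣ n → ∃ k, Odd k ∧ (p : ℤ) ∣ a ^ k + 1) :
    ∃ m, Odd m ∧ (n : ℤ) ∣ a ^ m + 1 := by
  induction n using induction_on_primes with
  | zero => exact absurd rfl hn
  | one => exact ⟨1, odd_one, by simp⟩
  | prime_mul p n hp ih =>
    obtain ⟨hpo, hno⟩ := Nat.odd_mul.mp hodd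
    obtain ⟨m, hm, hnm⟩ := ih hno.pos.ne' hno fun q hq hqn => h q hq (hqn.mul_left p)
    obtain ⟨k, hk, hpk⟩ := h p hp (dvd_mul_right p n)
    refine ⟨m * k * p, (hm.mul hk).mul hpo, ?_⟩
    have hn' : (n : ℤ) ∣ a ^ (m * k) + 1 := by
      rw [pow_mul]
      exact hnm.trans (by simpa using hk.add_dvd_pow_add_pow (a ^ m) 1)
    have hp' : (p : ℤ) ∣ a ^ (m * k) + 1 := by
      rw [mul_comm m k, pow_mul]
      exact hpk.trans (by simpa using hm.add_dvd_pow_add_pow (a ^ k) 1)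
    have hgeom := geom_sum_mul (-a ^ (m * k)) p
    rw [hpo.neg_pow, ← pow_mul] at hgeom
    have hsum : (p : ℤ) ∣ ∑ i ∈ Finset.range p, (-a ^ (m * k)) ^ i := by
      have h1 : -a ^ (m * k) ≡ 1 [ZMOD p] := by
        refine (Int.modEq_iff_dvd).mpr ?_
        rwa [sub_neg_eq_add, add_comm]
      have h2 : ∑ i ∈ Finset.range p, (-a ^ (m * k)) ^ i ≡
          ∑ _i ∈ Finset.range p, 1 [ZMOD p] :=
        Int.ModEq.sum fun i _ => by simpa using h1.pow i
      refine h2.dvd_iff.mpr ?_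
      simp
    rw [show a ^ (m * k * p) + 1 =
        (∑ i ∈ Finset.range p, (-a ^ (m * k)) ^ i) * (a ^ (m * k) + 1) by
      linear_combination hgeom, Nat.cast_mul]
    exact mul_dvd_mul hsum hn'

/-- If `2` has order `2` mod `4` modulo a prime `p`, then `p` divides `2 ^ k + 1` for some odd
`k`. -/
theorem exists_odd_prime_dvd_two_pow_add_one {p : ℕ} (hp : p.Prime)
    (h : orderOf (2 : ZMod p) % 4 = 2) : ∃ k, Odd k ∧ (p : ℤ) ∣ 2 ^ k + 1 := by
  have := Fact.mk hp
  refine ⟨orderOf (2 : ZMod p) / 2, Nat.odd_iff.mpr (by omega), ?_⟩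
  have hsq : ((2 : ZMod p) ^ (orderOf (2 : ZMod p) / 2)) ^ 2 = 1 := by
    rw [← pow_mul, Nat.div_mul_cancel (by omega), pow_orderOf_eq_one]
  rw [← ZMod.intCast_zmod_eq_zero_iff_dvd]
  push_cast
  rcases mul_self_eq_one_iff.mp (sq (_ : ZMod p) ▸ hsq) with h1 | h1
  · have := orderOf_dvd_of_pow_eq_one h1
    have := Nat.le_of_dvd (by omega) this
    omega
  · rw [h1, neg_add_cancel]

/-- If `g` is not a power of `g ^ 2`, then some set contains exactly one of `x` and `g * x`
for every `x`. -/
theorem exists_set_mul_mem_iff_notMem {G : Type*} [CommGroup G] {g : G}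
    (hg : g ∉ Subgroup.zpowers (g ^ 2)) : ∃ S : Set G, ∀ x, g * x ∈ S ↔ x ∉ S := by
  let r (x : G) : G := (QuotientGroup.mk x : G ⧸ Subgroup.zpowers g).out
  have hr (x : G) : (r x)⁻¹ * x ∈ Subgroup.zpowers g :=
    QuotientGroup.eq.mp (QuotientGroup.out_eq' _)
  have hrg (x : G) : r (g * x) = r x :=
    congrArg Quotient.out (QuotientGroup.eq.mpr (by simp [mul_comm g x]))
  refine ⟨{x | (r x)⁻¹ * x ∈ Subgroup.zpowers (g ^ 2)}, fun x => ?_⟩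
  simp only [Set.mem_ofPred_eq, hrg, mul_left_comm _ g]
  refine ⟨fun h1 h2 => hg ((Subgroup.mul_mem_cancel_right _ h2).mp h1), fun h1 => ?_⟩
  obtain ⟨i, hi⟩ := Subgroup.mem_zpowers_iff.mp (hr x)
  rw [← hi] at h1 ⊢
  rcases Int.even_or_odd' i with ⟨j, rfl | rfl⟩
  · exact absurd ⟨j, by simp [zpow_mul]⟩ h1
  · refine ⟨j + 1, ?_⟩
    rw [← zpow_one_add]
    simp only [← zpow_natCast g 2, ← zpow_mul]
    congr 1
    push_cast
    ring

/-- An element with an odd power that is a nontrivial involution is not a power of its square. -/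
theorem notMem_zpowers_sq_of_odd_pow {G : Type*} [Group G] {g : G} {m : ℕ}
    (hsq : (g ^ m) ^ 2 = 1) (hne : g ^ m ≠ 1) : g ∉ Subgroup.zpowers (g ^ 2) := by
  rintro ⟨j, hj⟩
  apply hne
  nth_rewrite 1 [← hj]
  simp only [← zpow_natCast, ← zpow_mul] at hsq ⊢
  rw [show ((2 : ℕ) : ℤ) * j * m = m * (2 : ℕ) * j by ring, zpow_mul, hsq, one_zpow]


/-- Let `n > 1` be an integer all of whose prime divisors `p` satisfy
`ord_p(2) ≡ 2 (mod 4)`. Then the set `G_n` of units of `ZMod n` admits a partition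
into unordered pairs of the form `{x, 2x}` whose set of differences `{±x}` is
exactly `G_n`. -/
theorem units_cardioidal_partition (n : ℕ) (hn : 1 < n)
    (h : ∀ p : ℕ, p.Prime → p ∣ n → orderOf (2 : ZMod p) % 4 = 2) :
    ∃ A : Finset (Sym2 (ZMod n)),
      (∀ s ∈ A, ¬ s.IsDiag) ∧
      (∀ s ∈ A, ∃ x : ZMod n, s = s(x, 2 * x)) ∧
      (∀ s ∈ A, ∀ y ∈ s, IsUnit y) ∧
      (∀ x : ZMod n, IsUnit x → ∃! s, s ∈ A ∧ x ∈ s) ∧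
      {d : ZMod n | ∃ x : ZMod n, s(x, 2 * x) ∈ A ∧ (d = x ∨ d = -x)} =
        {x : ZMod n | IsUnit x} := by
  classical
  have := Fact.mk hn
  have hodd : Odd n := by
    by_contra hne
    have h2 := h 2 Nat.prime_two (even_iff_two_dvd.mp (Nat.not_odd_iff_even.mp hne))
    have h0 : (2 : ZMod 2) = 0 := rfl
    simp [h0] at h2
  obtain ⟨m, hm, hnm⟩ := exists_odd_dvd_pow_add_one (a := 2) (by omega) hodd fun p hp hpn =>
    exists_odd_prime_dvd_two_pow_add_one hp (h p hp hpn)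
  let g : (ZMod n)ˣ := ZMod.unitOfCoprime 2 (Nat.coprime_two_left.mpr hodd)
  have hg : (g : ZMod n) = 2 := by simp [g]
  have hgm : g ^ m = -1 := by
    ext
    rw [← ZMod.intCast_zmod_eq_zero_iff_dvd] at hnm
    push_cast [hg] at hnm ⊢
    exact eq_neg_of_add_eq_zero_left hnm
  have hneg : (-1 : (ZMod n)ˣ) ≠ 1 := fun he => by
    have := Fact.mk (show 2 < n by rcases hodd with ⟨k, rfl⟩; omega)
    exact ZMod.neg_one_ne_one (congrArg Units.val he)
  obtain ⟨S, hS⟩ := exists_set_mul_mem_iff_notMem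
    (notMem_zpowers_sq_of_odd_pow (g := g) (m := m) (by simp [hgm]) (by rwa [hgm]))
  have hS2 (k : ℕ) (x : (ZMod n)ˣ) : g ^ (2 * k) * x ∈ S ↔ x ∈ S := by
    induction k with
    | zero => simp
    | succ k ih => rw [mul_add_one, pow_add, mul_comm (g ^ _), mul_assoc, sq, mul_assoc, hS, hS,
        not_not, ih]
  have hSneg (x : (ZMod n)ˣ) : -x ∈ S ↔ x ∉ S := by
    obtain ⟨k, rfl⟩ := hm
    rw [← neg_one_mul, ← hgm, pow_succ', mul_assoc, hS, hS2]
  have hA (s : Sym2 (ZMod n)) :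
      s ∈ S.toFinset.image (fun x => s((x : ZMod n), 2 * x)) ↔
        ∃ x ∈ S, s((x : ZMod n), ((g * x : (ZMod n)ˣ) : ZMod n)) = s := by
    simp [hg]
  refine ⟨S.toFinset.image fun x => s((x : ZMod n), 2 * x), ?_, ?_, ?_, ?_, ?_⟩
  · simp only [hA]
    rintro _ ⟨x, hx, rfl⟩ hd
    have hgx : x = g * x := Units.ext hd
    exact (hS x).mp (hgx ▸ hx) hx
  · simp only [hA]
    rintro _ ⟨x, -, rfl⟩
    exact ⟨x, by simp [hg]⟩
  · simp only [hA]
    rintro _ ⟨x, -, rfl⟩ y hy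
    rcases Sym2.mem_iff.mp hy with rfl | rfl <;> exact Units.isUnit _
  · simp only [hA]
    rintro _ ⟨x, rfl⟩
    by_cases hx : x ∈ S
    · refine ⟨_, ⟨⟨x, hx, rfl⟩, Sym2.mem_mk_left _ _⟩, ?_⟩
      rintro _ ⟨⟨z, hz, rfl⟩, hxz⟩
      rcases Sym2.mem_iff.mp hxz with e | e
      · rw [Units.ext e]
      · exact absurd hz ((hS z).mp (Units.ext e ▸ hx))
    · have hx' : g⁻¹ * x ∈ S := by
        by_contra hc
        exact hx (by simpa using (hS _).mpr hc)
      refine ⟨_, ⟨⟨g⁻¹ * x, hx', rfl⟩, by simp [-Units.val_mul]⟩, ?_⟩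
      rintro _ ⟨⟨z, hz, rfl⟩, hxz⟩
      rcases Sym2.mem_iff.mp hxz with e | e
      · exact absurd (Units.ext e ▸ hz) hx
      · rw [Units.ext e, inv_mul_cancel_left]
  · ext d
    simp only [hA, Set.mem_ofPred_eq]
    constructor
    · rintro ⟨x, ⟨z, -, hz⟩, hd⟩
      have hx : IsUnit x := by
        have hmem := Sym2.mem_mk_left x (2 * x)
        rw [← hz] at hmem
        rcases Sym2.mem_iff.mp hmem with rfl | rfl <;> exact Units.isUnit _
      rcases hd with rfl | rfl
      exacts [hx, hx.neg]
    · rintro ⟨x, rfl⟩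
      by_cases hx : x ∈ S
      · exact ⟨x, ⟨x, hx, by simp [hg]⟩, Or.inl rfl⟩
      · exact ⟨(-x : (ZMod n)ˣ), ⟨-x, (hSneg x).mpr hx, by simp [hg]⟩, Or.inr (by simp)⟩
end

section
/- Let p be a prime with p ≡ 1 (mod 8) such that the multiplicative order of 2 modulo p is divisible by 4. Then there is no cardioidal starter of order p. -/
/-- In a cardioidal starter exactly one of the pairs `{x, 2x}` and `{2x, 4x}` occurs. -/
theorem IsStarter.mem_two_mul_iff {p : ℕ} [Fact p.Prime] (h2 : (2 : ZMod p) ≠ 0)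
    (h3 : (3 : ZMod p) ≠ 0) {S : Finset (Sym2 (ZMod p))} (hS : IsStarter p S)
    (hC : IsCardioidal p S) {x : ZMod p} (hx : x ≠ 0) :
    s(2 * x, 2 * (2 * x)) ∈ S ↔ s(x, 2 * x) ∉ S := by
  obtain ⟨s, ⟨hs, hxs⟩, hu⟩ := hS.2.2.1 (2 * x) (mul_ne_zero h2 hx)
  constructor
  · intro h h'
    have e := (hu _ ⟨h, by simp⟩).trans (hu _ ⟨h', by simp⟩).symm
    rw [Sym2.eq_iff] at e
    rcases e with ⟨e, -⟩ | ⟨-, e⟩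
    · exact hx (by linear_combination e)
    · exact mul_ne_zero h3 hx (by linear_combination e)
  · intro h
    obtain ⟨y, -, rfl⟩ := hC s hs
    rcases Sym2.mem_iff.1 hxs with e | e
    · rwa [e]
    · exact absurd (mul_left_cancel₀ h2 e ▸ hs) h

theorem IsStarter.mem_four_pow_mul_iff {p : ℕ} [Fact p.Prime] (h2 : (2 : ZMod p) ≠ 0)
    (h3 : (3 : ZMod p) ≠ 0) {S : Finset (Sym2 (ZMod p))} (hS : IsStarter p S)
    (hC : IsCardioidal p S) {x : ZMod p} (hx : x ≠ 0) (k : ℕ) :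
    s(2 ^ (2 * k) * x, 2 * (2 ^ (2 * k) * x)) ∈ S ↔ s(x, 2 * x) ∈ S := by
  induction k with
  | zero => simp
  | succ k ih =>
    have h0 : (2 : ZMod p) ^ (2 * k) * x ≠ 0 := mul_ne_zero (pow_ne_zero _ h2) hx
    have e : (2 : ZMod p) ^ (2 * (k + 1)) * x = 2 * (2 * (2 ^ (2 * k) * x)) := by ring
    rw [e, hS.mem_two_mul_iff h2 h3 hC (mul_ne_zero h2 h0), hS.mem_two_mul_iff h2 h3 hC h0,
      not_not, ih]

theorem exists_two_pow_two_mul_eq_neg_one {p : ℕ} [Fact p.Prime] (h2 : (2 : ZMod p) ≠ 0)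
    (h4 : 4 ∣ orderOf (2 : ZMod p)) : ∃ k : ℕ, (2 : ZMod p) ^ (2 * k) = -1 := by
  obtain ⟨k, hk⟩ := h4
  have hpos : 0 < orderOf (2 : ZMod p) :=
    orderOf_pos_iff.2 (isOfFinOrder_iff_pow_eq_one.2
      ⟨p - 1, Nat.sub_pos_of_lt (Fact.out : p.Prime).one_lt, ZMod.pow_card_sub_one_eq_one h2⟩)
  have hsq : ((2 : ZMod p) ^ (2 * k)) ^ 2 = 1 := by
    rw [← pow_mul, show 2 * k * 2 = orderOf (2 : ZMod p) by omega, pow_orderOf_eq_one]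
  exact ⟨k, (mul_self_eq_one_iff.1 ((sq _).symm.trans hsq)).resolve_left
    (pow_ne_one_of_lt_orderOf (by omega) (by omega))⟩

/-- For a prime `p ≡ 1 (mod 8)` with `4 ∣ ord_p(2)`, there is no cardioidal
starter of order `p`. -/
theorem no_cardioidal_starter_of_prime (p : ℕ) (hp : p.Prime) (h8 : p % 8 = 1)
    (h4 : 4 ∣ orderOf (2 : ZMod p)) :
    ¬ ∃ S : Finset (Sym2 (ZMod p)), IsStarter p S ∧ IsCardioidal p S := by
  rintro ⟨S, hS, hC⟩
  have := Fact.mk hp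
  have hlt : 3 < p := by have := hp.one_lt; omega
  have h2 : (2 : ZMod p) ≠ 0 := fun h => absurd
    (Nat.le_of_dvd two_pos ((ZMod.natCast_eq_zero_iff 2 p).1 (mod_cast h))) (by omega)
  have h3 : (3 : ZMod p) ≠ 0 := fun h => absurd
    (Nat.le_of_dvd three_pos ((ZMod.natCast_eq_zero_iff 3 p).1 (mod_cast h))) (by omega)
  obtain ⟨k, hk⟩ := exists_two_pow_two_mul_eq_neg_one h2 h4
  have hneg := hS.mem_four_pow_mul_iff h2 h3 hC (one_ne_zero (α := ZMod p)) k
  rw [hk, mul_one, mul_one, mul_neg_one] at hneg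
  obtain ⟨s, ⟨hs, a, b, hab, hd⟩, hu⟩ := hS.2.2.2 1 one_ne_zero
  have h1 : s((1 : ZMod p), 2) ∈ S := by
    obtain ⟨y, -, rfl⟩ := hC s hs
    have hy : y = 1 ∨ y = -1 := by
      rcases Sym2.eq_iff.1 hab with ⟨rfl, rfl⟩ | ⟨rfl, rfl⟩ <;> rcases hd with hd | hd
      · right; linear_combination hd
      · left; linear_combination -hd
      · left; linear_combination -hd
      · right; linear_combination hd
    rcases hy with rfl | rfl
    · rwa [mul_one] at hs
    · rw [mul_neg_one] at hs
      exact hneg.1 hs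
  have e := (hu _ ⟨h1, 1, 2, rfl, Or.inr (by ring)⟩).trans
    (hu _ ⟨hneg.2 h1, -1, -2, rfl, Or.inl (by ring)⟩).symm
  rcases Sym2.eq_iff.1 e with ⟨e, -⟩ | ⟨e, -⟩
  · exact h2 (by linear_combination e)
  · exact h3 (by linear_combination e)
end

section
/- Let n ≥ 3 be an odd integer and let p be a prime divisor of n such that the multiplicative order of 2 modulo p is not congruent to 2 modulo 4. Then there is no cardioidal starter of order n. -/
/-- Multiples of `n / p` in `ZMod n` vanish exactly when the multiplier vanishes in `ZMod p`. -/
lemma intCast_mul_natCast_div_eq_zero_iff {n p : ℕ} (hn : n ≠ 0) (hpn : p ∣ n) (m : ℤ) :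
    (m : ZMod n) * ((n / p : ℕ) : ZMod n) = 0 ↔ (m : ZMod p) = 0 := by
  obtain ⟨k, rfl⟩ := hpn
  have hp0 : 0 < p := Nat.pos_of_ne_zero (left_ne_zero_of_mul hn)
  have hk : (k : ℤ) ≠ 0 := by exact_mod_cast right_ne_zero_of_mul hn
  rw [Nat.mul_div_cancel_left k hp0, ← Int.cast_natCast k, ← Int.cast_mul,
    ZMod.intCast_zmod_eq_zero_iff_dvd, ZMod.intCast_zmod_eq_zero_iff_dvd, Nat.cast_mul,
    mul_dvd_mul_iff_right hk]

/-- In a cardioidal starter, exactly one of `{z, 2z}` and `{2z, 4z}` is a pair, unless `3z = 0`. -/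
lemma IsCardioidal.pair_mem_iff_double_notMem {n : ℕ} {S : Finset (Sym2 (ZMod n))}
    (hodd : Odd n) (hS : IsStarter n S) (hC : IsCardioidal n S) {z : ZMod n}
    (hz : z ≠ 0) (hz3 : 3 * z ≠ 0) :
    s(z, 2 * z) ∈ S ↔ s(2 * z, 2 * (2 * z)) ∉ S := by
  have h2 : IsUnit (2 : ZMod n) := by
    simpa using (ZMod.isUnit_iff_coprime 2 n).2 (Nat.coprime_two_left.2 hodd)
  obtain ⟨s, ⟨hs, hzs⟩, huniq⟩ := hS.2.2.1 (2 * z) (fun h => hz (h2.mul_right_eq_zero.1 h))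
  constructor
  · intro h h'
    have e := (huniq _ ⟨h, by simp⟩).trans (huniq _ ⟨h', by simp⟩).symm
    rw [Sym2.eq_iff] at e
    rcases e with ⟨e, -⟩ | ⟨e, -⟩
    · exact hz (by linear_combination -e)
    · exact hz3 (by linear_combination -e)
  · intro h
    obtain ⟨y, -, rfl⟩ := hC s hs
    rcases Sym2.mem_iff.1 hzs with e | e
    · exact absurd (e ▸ hs) h
    · rwa [h2.mul_left_cancel e]

/-- In a starter, `{z, 2z}` and `{-z, -2z}` are not both pairs, unless `2z = 0` or `3z = 0`. -/
lemma IsStarter.pair_neg_notMem {n : ℕ} {S : Finset (Sym2 (ZMod n))} (hS : IsStarter n S)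
    {z : ZMod n} (hz : z ≠ 0) (hz2 : 2 * z ≠ 0) (hz3 : 3 * z ≠ 0) (h : s(z, 2 * z) ∈ S) :
    s(-z, 2 * -z) ∉ S := by
  intro h'
  have e := (hS.2.2.2 z hz).unique ⟨h, z, 2 * z, rfl, Or.inr (by ring)⟩
    ⟨h', -z, 2 * -z, rfl, Or.inl (by ring)⟩
  rw [Sym2.eq_iff] at e
  rcases e with ⟨e, -⟩ | ⟨e, -⟩
  · exact hz2 (by linear_combination e)
  · exact hz3 (by linear_combination e)

/-- If a prime `p` dividing an odd `n ≥ 3` has `ord_p(2) ≢ 2 (mod 4)`, then there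
is no cardioidal starter of order `n`. -/
theorem no_cardioidal_starter_of_bad_prime_divisor (n : ℕ) (hn : 3 ≤ n) (hodd : Odd n)
    (p : ℕ) (hp : p.Prime) (hpn : p ∣ n) (h : orderOf (2 : ZMod p) % 4 ≠ 2) :
    ¬ ∃ S : Finset (Sym2 (ZMod n)), IsStarter n S ∧ IsCardioidal n S := by
  rintro ⟨S, hS, hC⟩
  have : Fact p.Prime := ⟨hp⟩
  have hp2 : (2 : ZMod p) ≠ 0 := by
    intro h0
    have hdvd : p ∣ 2 := (ZMod.natCast_eq_zero_iff 2 p).1 (by exact_mod_cast h0)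
    obtain rfl := (Nat.prime_dvd_prime_iff_eq hp Nat.prime_two).1 hdvd
    exact Nat.not_even_iff_odd.2 hodd (even_iff_two_dvd.2 hpn)
  have hp3 : (3 : ZMod p) ≠ 0 := by
    intro h0
    have hdvd : p ∣ 3 := (ZMod.natCast_eq_zero_iff 3 p).1 (by exact_mod_cast h0)
    obtain rfl := (Nat.prime_dvd_prime_iff_eq hp Nat.prime_three).1 hdvd
    exact h (by rw [orderOf_eq_prime (p := 2) (by decide) (by decide)])
  have hmul := intCast_mul_natCast_div_eq_zero_iff (n := n) (by omega) hpn
  set u : ZMod n := ((n / p : ℕ) : ZMod n)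
  have hne (i : ℕ) : 2 ^ i * u ≠ 0 := by
    have := (hmul (2 ^ i)).not
    push_cast at this
    exact this.2 (pow_ne_zero i hp2)
  have hne3 (i : ℕ) : 3 * (2 ^ i * u) ≠ 0 := by
    have := (hmul (3 * 2 ^ i)).not
    push_cast at this
    rw [← mul_assoc]
    exact this.2 (mul_ne_zero hp3 (pow_ne_zero i hp2))
  have hne2 (i : ℕ) : 2 * (2 ^ i * u) ≠ 0 := by
    rw [← mul_assoc, ← pow_succ']
    exact hne (i + 1)
  have hstep (i : ℕ) := hC.pair_mem_iff_double_notMem hodd hS (hne i) (hne3 i)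
  have halt (i : ℕ) : s(2 ^ i * u, 2 * (2 ^ i * u)) ∈ S ↔ (Even i ↔ s(u, 2 * u) ∈ S) := by
    induction i with
    | zero => simp
    | succ i ih =>
      have hi := hstep i
      rw [pow_succ', mul_assoc, Nat.even_add_one]
      tauto
  set d := orderOf (2 : ZMod p)
  have hdpos : 0 < d :=
    orderOf_pos_iff.2 (isOfFinOrder_iff_pow_eq_one.2
      ⟨p - 1, by have := hp.two_le; omega, ZMod.pow_card_sub_one_eq_one hp2⟩)
  have hd1 : (2 : ZMod p) ^ d = 1 := pow_orderOf_eq_one 2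
  have hdu : 2 ^ d * u = u := by
    have := (hmul (2 ^ d - 1)).2 (by push_cast; rw [hd1, sub_self])
    push_cast at this
    linear_combination this
  have hdeven : Even d := by
    have := halt d
    rw [hdu] at this
    tauto
  obtain ⟨k, hk⟩ : ∃ k, d = 4 * k := by
    obtain ⟨m, hm⟩ := hdeven
    exact ⟨d / 4, by omega⟩
  have hneg : (2 : ZMod p) ^ (2 * k) = -1 := by
    refine (sq_eq_one_iff.1 ?_).resolve_left (pow_ne_one_of_lt_orderOf (by omega) (by omega))
    rw [← pow_mul, ← hd1, hk]
    ring_nf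
  have hnegu (i : ℕ) : 2 ^ (i + 2 * k) * u = -(2 ^ i * u) := by
    have := (hmul (2 ^ (2 * k) + 1)).2 (by push_cast; rw [hneg, neg_add_cancel])
    push_cast at this
    rw [pow_add]
    linear_combination 2 ^ i * this
  obtain ⟨i, hi⟩ : ∃ i : ℕ, s(2 ^ i * u, 2 * (2 ^ i * u)) ∈ S := by
    by_cases h0 : s(u, 2 * u) ∈ S
    · exact ⟨0, by simpa using h0⟩
    · exact ⟨1, (halt 1).2 (by simp [h0])⟩
  apply hS.pair_neg_notMem (hne i) (hne2 i) (hne3 i) hi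
  rw [← hnegu, halt, ← (halt i).1 hi, Nat.even_add]
  simp
end

section
/- Let p be a prime with p ≡ 3 (mod 8) and p > 3. Then ℤ_p admits a strong Skolem starter; consequently, there exist infinitely many n such that ℤ_n admits a strong Skolem starter. -/
/-- The pairs `{x, 2x}` with `x` a nonzero quadratic residue. -/
noncomputable def residueDoubling (p : ℕ) [Fact p.Prime] : Finset (Sym2 (ZMod p)) :=
  (Finset.univ.filter fun x : ZMod p => quadraticChar (ZMod p) x = 1).image
    fun x => s(x, 2 * x)

section ResidueDoubling

variable {p : ℕ} [Fact p.Prime]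

theorem mem_residueDoubling {s : Sym2 (ZMod p)} :
    s ∈ residueDoubling p ↔ ∃ x : ZMod p, quadraticChar (ZMod p) x = 1 ∧ s = s(x, 2 * x) := by
  simp [residueDoubling, eq_comm]

theorem ne_zero_of_quadraticChar_eq_one {x : ZMod p} (hx : quadraticChar (ZMod p) x = 1) :
    x ≠ 0 := by
  rintro rfl
  simp at hx

theorem quadraticChar_neg_one_of_three_mod_eight (h8 : p % 8 = 3) :
    quadraticChar (ZMod p) (-1) = -1 := by
  rw [quadraticChar_neg_one_iff_not_isSquare, ZMod.exists_sq_eq_neg_one_iff]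
  omega

theorem quadraticChar_two_of_three_mod_eight (h8 : p % 8 = 3) :
    quadraticChar (ZMod p) 2 = -1 := by
  rw [quadraticChar_neg_one_iff_not_isSquare, ZMod.exists_sq_eq_two_iff (by omega)]
  omega

theorem quadraticChar_neg_of_three_mod_eight (h8 : p % 8 = 3) (x : ZMod p) :
    quadraticChar (ZMod p) (-x) = -quadraticChar (ZMod p) x := by
  rw [← neg_one_mul, map_mul, quadraticChar_neg_one_of_three_mod_eight h8, neg_one_mul]

theorem quadraticChar_two_mul_of_three_mod_eight (h8 : p % 8 = 3) (x : ZMod p) :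
    quadraticChar (ZMod p) (2 * x) = -quadraticChar (ZMod p) x := by
  rw [map_mul, quadraticChar_two_of_three_mod_eight h8, neg_one_mul]

theorem isStarter_residueDoubling (h8 : p % 8 = 3) : IsStarter p (residueDoubling p) := by
  have hneg := quadraticChar_neg_of_three_mod_eight h8
  have hdbl := quadraticChar_two_mul_of_three_mod_eight h8
  have h2 : (2 : ZMod p) ≠ 0 := by
    intro h
    have := quadraticChar_two_of_three_mod_eight h8
    simp [h] at this
  refine ⟨?_, ?_, ?_, ?_⟩
  · intro s hs
    obtain ⟨x, hx, rfl⟩ := mem_residueDoubling.1 hs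
    have hx0 := ne_zero_of_quadraticChar_eq_one hx
    rw [Sym2.mk_isDiag_iff]
    intro h
    exact hx0 (by linear_combination -h)
  · intro s hs y hy
    obtain ⟨x, hx, rfl⟩ := mem_residueDoubling.1 hs
    have hx0 := ne_zero_of_quadraticChar_eq_one hx
    rcases Sym2.mem_iff.1 hy with rfl | rfl
    · exact hx0
    · exact mul_ne_zero h2 hx0
  · intro x hx0
    rcases quadraticChar_dichotomy hx0 with hx | hx
    · refine ⟨s(x, 2 * x), ⟨mem_residueDoubling.2 ⟨x, hx, rfl⟩, Sym2.mem_mk_left _ _⟩, ?_⟩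
      rintro s ⟨hs, hxs⟩
      obtain ⟨y, hy, rfl⟩ := mem_residueDoubling.1 hs
      rcases Sym2.mem_iff.1 hxs with rfl | rfl
      · rfl
      · rw [hdbl, hy] at hx
        norm_num at hx
    · have hhalf : 2 * (x / 2) = x := mul_div_cancel₀ x h2
      have hy : quadraticChar (ZMod p) (x / 2) = 1 := by
        have := hdbl (x / 2)
        rw [hhalf, hx] at this
        omega
      refine ⟨s(x / 2, 2 * (x / 2)), ⟨mem_residueDoubling.2 ⟨_, hy, rfl⟩, ?_⟩, ?_⟩
      · rw [hhalf]
        exact Sym2.mem_mk_right _ _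
      · rintro s ⟨hs, hxs⟩
        obtain ⟨z, hz, rfl⟩ := mem_residueDoubling.1 hs
        rcases Sym2.mem_iff.1 hxs with rfl | rfl
        · rw [hz] at hx
          norm_num at hx
        · rw [mul_div_cancel_left₀ z h2]
  · have hdiff : ∀ x y a b : ZMod p, s(y, 2 * y) = s(a, b) → (x = a - b ∨ x = b - a) →
        y = x ∨ y = -x := by
      intro x y a b hab hx
      rcases Sym2.eq_iff.1 hab with ⟨rfl, rfl⟩ | ⟨rfl, rfl⟩ <;> rcases hx with rfl | rfl <;>
        ring_nf <;> simp
    intro x hx0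
    rcases quadraticChar_dichotomy hx0 with hx | hx
    · refine ⟨s(x, 2 * x), ⟨mem_residueDoubling.2 ⟨x, hx, rfl⟩, x, 2 * x, rfl,
        Or.inr (by ring)⟩, ?_⟩
      rintro s ⟨hs, a, b, hab, hd⟩
      obtain ⟨y, hy, rfl⟩ := mem_residueDoubling.1 hs
      rcases hdiff x y a b hab hd with rfl | rfl
      · rfl
      · rw [hneg, hx] at hy
        norm_num at hy
    · refine ⟨s(-x, 2 * -x), ⟨mem_residueDoubling.2 ⟨-x, by rw [hneg, hx, neg_neg], rfl⟩,
        -x, 2 * -x, rfl, Or.inl (by ring)⟩, ?_⟩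
      rintro s ⟨hs, a, b, hab, hd⟩
      obtain ⟨y, hy, rfl⟩ := mem_residueDoubling.1 hs
      rcases hdiff x y a b hab hd with rfl | rfl
      · rw [hx] at hy
        norm_num at hy
      · rfl

theorem isStrongStarter_residueDoubling (h8 : p % 8 = 3) (h3 : 3 < p) :
    IsStrongStarter p (residueDoubling p) := by
  have h3' : (3 : ZMod p) ≠ 0 := by
    intro h
    have h' : ((3 : ℕ) : ZMod p) = 0 := by exact_mod_cast h
    have := Nat.le_of_dvd (by norm_num) ((ZMod.natCast_eq_zero_iff 3 p).1 h')
    omega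
  have hsum : ∀ x a b : ZMod p, s(x, 2 * x) = s(a, b) → a + b = 3 * x := by
    intro x a b hab
    rcases Sym2.eq_iff.1 hab with ⟨rfl, rfl⟩ | ⟨rfl, rfl⟩ <;> ring
  refine ⟨isStarter_residueDoubling h8, ?_, ?_⟩
  · intro s hs a b hab
    obtain ⟨x, hx, rfl⟩ := mem_residueDoubling.1 hs
    rw [hsum x a b hab]
    exact mul_ne_zero h3' (ne_zero_of_quadraticChar_eq_one hx)
  · intro s hs t ht a b c d hab hcd h
    obtain ⟨x, hx, rfl⟩ := mem_residueDoubling.1 hs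
    obtain ⟨y, hy, rfl⟩ := mem_residueDoubling.1 ht
    rw [hsum x a b hab, hsum y c d hcd] at h
    rw [mul_left_cancel₀ h3' h]

theorem isSkolemStarter_residueDoubling (h8 : p % 8 = 3) :
    IsSkolemStarter p (residueDoubling p) := by
  have hneg := quadraticChar_neg_of_three_mod_eight h8
  have hcast0 : ∀ i ∈ Finset.Icc 1 ((p - 1) / 2), (i : ZMod p) ≠ 0 := by
    intro i hi h
    rw [Finset.mem_Icc] at hi
    have := Nat.le_of_dvd (by omega) ((ZMod.natCast_eq_zero_iff i p).1 h)
    omega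
  refine ⟨isStarter_residueDoubling h8,
    fun i => if quadraticChar (ZMod p) i = 1 then ((i : ZMod p), ((2 * i : ℕ) : ZMod p))
      else (((p - 2 * i : ℕ) : ZMod p), ((p - i : ℕ) : ZMod p)), ?_, ?_⟩
  · have hpair : ∀ i ∈ Finset.Icc 1 ((p - 1) / 2),
        s(((p - 2 * i : ℕ) : ZMod p), ((p - i : ℕ) : ZMod p)) =
          s(-(i : ZMod p), 2 * -(i : ZMod p)) := by
      intro i hi
      rw [Finset.mem_Icc] at hi
      rw [Nat.cast_sub (by omega), Nat.cast_sub (by omega), Sym2.eq_swap]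
      simp
    ext s
    rw [mem_residueDoubling, Finset.mem_image]
    constructor
    · rintro ⟨x, hx, rfl⟩
      have hx0 := ne_zero_of_quadraticChar_eq_one hx
      have hlt := x.val_lt
      have hpos : 0 < x.val := Nat.pos_of_ne_zero fun h => hx0 ((ZMod.val_eq_zero x).1 h)
      by_cases hle : x.val ≤ (p - 1) / 2
      · refine ⟨x.val, Finset.mem_Icc.2 ⟨hpos, hle⟩, ?_⟩
        simp [hx]
      · have hi : p - x.val ∈ Finset.Icc 1 ((p - 1) / 2) := by
          rw [Finset.mem_Icc]
          omega
        have hcast : ((p - x.val : ℕ) : ZMod p) = -x := by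
          rw [Nat.cast_sub hlt.le]
          simp
        have hne : quadraticChar (ZMod p) ((p - x.val : ℕ) : ZMod p) ≠ 1 := by
          rw [hcast, hneg, hx]
          norm_num
        refine ⟨p - x.val, hi, ?_⟩
        dsimp only
        rw [if_neg hne, hpair _ hi, hcast, neg_neg]
    · rintro ⟨i, hi, rfl⟩
      by_cases hq : quadraticChar (ZMod p) (i : ZMod p) = 1
      · exact ⟨i, hq, by simp [hq]⟩
      · refine ⟨-(i : ZMod p), ?_, by dsimp only; rw [if_neg hq, hpair i hi]⟩
        rw [hneg, (quadraticChar_dichotomy (hcast0 i hi)).resolve_left hq, neg_neg]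
  · intro i hi
    rw [Finset.mem_Icc] at hi
    dsimp only
    split_ifs
    · rw [ZMod.val_natCast_of_lt (by omega), ZMod.val_natCast_of_lt (by omega)]
      refine ⟨?_, by omega⟩
      push_cast
      ring
    · rw [ZMod.val_natCast_of_lt (by omega), ZMod.val_natCast_of_lt (by omega),
        Nat.cast_sub (by omega), Nat.cast_sub (by omega)]
      refine ⟨?_, by omega⟩
      push_cast
      ring

end ResidueDoubling

theorem exists_strong_skolem_starter {p : ℕ} (hp : p.Prime) (h8 : p % 8 = 3) (h3 : 3 < p) :
    ∃ S : Finset (Sym2 (ZMod p)), IsStrongStarter p S ∧ IsSkolemStarter p S :=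
  haveI : Fact p.Prime := ⟨hp⟩
  ⟨residueDoubling p, isStrongStarter_residueDoubling h8 h3, isSkolemStarter_residueDoubling h8⟩

/-- For any prime `p ≡ 3 (mod 8)`, `p > 3`, `ℤ_p` admits a strong Skolem starter;
consequently, there exist infinitely many `n` such that `ℤ_n` admits a strong
Skolem starter. -/
theorem strong_skolem_starter_of_prime_three_mod_eight (p : ℕ) (hp : p.Prime)
    (h8 : p % 8 = 3) (h3 : 3 < p) :
    (∃ S : Finset (Sym2 (ZMod p)), IsStrongStarter p S ∧ IsSkolemStarter p S) ∧
      {n : ℕ | ∃ S : Finset (Sym2 (ZMod n)),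
        IsStrongStarter n S ∧ IsSkolemStarter n S}.Infinite := by
  refine ⟨exists_strong_skolem_starter hp h8 h3, ?_⟩
  have hunit : IsUnit ((3 : ℕ) : ZMod 8) := (ZMod.isUnit_iff_coprime 3 8).2 (by norm_num)
  refine ((Nat.infinite_setOfPred_prime_and_eq_mod hunit).sdiff (Set.finite_Iic 3)).mono ?_
  rintro n ⟨⟨hn, hmod⟩, hn3⟩
  have hn8 : n % 8 = 3 := (ZMod.natCast_eq_natCast_iff' n 3 8).1 hmod
  exact exists_strong_skolem_starter hn hn8 (not_le.1 hn3)
end
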